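/- Let K be a convex subset with nonempty interior in a real normed linear space X. Then the metric double complement -(-K) is a convex set. -/

import Mathlib

/-- The metric complement of a subset `S` of a normed space: the set of points
bounded away from `S`. -/
def metricCompl {X : Type*} [NormedAddCommGroup X] (S : Set X) : Set X :=
  {x : X | ∃ r > 0, ∀ y ∈ S, r ≤ ‖x - y‖}

theorem metricCompl_eq_compl_closure {X : Type*} [NormedAddCommGroup X] (S : Set X) :
    metricCompl S = (closure S)ᶜ := by
  ext x
  simp [metricCompl, Metric.mem_closure_iff, dist_eq_norm]

theorem metricCompl_metricCompl {X : Type*} [NormedAddCommGroup X] (S : Set X) :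
    metricCompl (metricCompl S) = interior (closure S) := by
  rw [metricCompl_eq_compl_closure, metricCompl_eq_compl_closure, closure_compl, compl_compl]

theorem convex_metricCompl_metricCompl_of_convex
    {X : Type*} [NormedAddCommGroup X] [NormedSpace ℝ X]
    (K : Set X) (hK : Convex ℝ K) (hint : (interior K).Nonempty) :
    Convex ℝ (metricCompl (metricCompl K)) := by
  rw [metricCompl_metricCompl]
  exact hK.closure.interior
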